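/- Let X be a countable type and let C and N be natural numbers. Suppose F : (Fin C → Fin N → X) → ℝ satisfies the two-level permutation invariance: for every permutation σ of Fin C, every family of permutations τ : Fin C → Equiv.Perm (Fin N), and every x : Fin C → Fin N → X, F(fun c i => x (σ c) (τ c i)) = F(x). Then there exist functions φ : X → ℝ, ρ₁ : ℝ → ℝ, and ρ₂ : ℝ → ℝ such that F(x) = ρ₂(∑_{c ∈ Fin C} ρ₁(∑_{i ∈ Fin N} φ(x c i))) for all x : Fin C → Fin N → X. -/

import Mathlib

/-- A countable type admits a real-valued map whose sums over finite families determine the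
families up to permutation. -/
theorem exists_real_map_sum_eq_imp_perm (X : Type*) [Countable X] :
    ∃ φ : X → ℝ, ∀ {ι : Type} [Fintype ι] (x y : ι → X),
      ∑ i, φ (x i) = ∑ i, φ (y i) → ∃ σ : Equiv.Perm ι, x = y ∘ σ := by
  classical
  let b := Module.Basis.ofVectorSpace ℚ ℝ
  have : Infinite (Module.Basis.ofVectorSpaceIndex ℚ ℝ) := by
    rw [Cardinal.infinite_iff, b.mk_eq_rank'', Real.rank_rat_real]
    exact Cardinal.aleph0_le_continuum
  obtain ⟨e, he⟩ := exists_injective_nat X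
  let f : X → Module.Basis.ofVectorSpaceIndex ℚ ℝ := fun a => Infinite.natEmbedding _ (e a)
  have hf : Function.Injective f := (Infinite.natEmbedding _).injective.comp he
  refine ⟨fun a => b (f a), fun {ι} _ x y h => ?_⟩
  have hli : LinearIndependent ℚ fun a => b (f a) := b.linearIndependent.comp f hf
  have key : ∑ i, Finsupp.single (x i) (1 : ℚ) = ∑ i, Finsupp.single (y i) 1 :=
    hli (by simpa using h)
  have hfib (a : X) : Nonempty ({i // x i = a} ≃ {i // y i = a}) := by
    have ha := DFunLike.congr_fun key a
    simp only [Finsupp.coe_finsetSum, Finset.sum_apply, Finsupp.single_apply,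
      Finset.sum_boole, Nat.cast_inj] at ha
    rwa [← Fintype.card_eq, Fintype.card_subtype, Fintype.card_subtype]
  exact ⟨Equiv.ofFiberEquiv fun a => (hfib a).some, funext fun i => (Equiv.ofFiberEquiv_map _ i).symm⟩

/-- **Set-of-Sets encoder, converse direction** (Appendix B). A two-level
permutation-invariant function on a countable domain decomposes hierarchically as
`F x = ρ₂ (∑ c, ρ₁ (∑ i, φ (x c i)))`. -/
theorem two_level_perm_invariant_set_of_sets_decomposition
    {X : Type*} [Countable X] (C N : ℕ) (F : (Fin C → Fin N → X) → ℝ)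
    (hF : ∀ (σ : Equiv.Perm (Fin C)) (τ : Fin C → Equiv.Perm (Fin N))
      (x : Fin C → Fin N → X),
      F (fun c i => x (σ c) (τ c i)) = F x) :
    ∃ (φ : X → ℝ) (ρ₁ ρ₂ : ℝ → ℝ), ∀ x : Fin C → Fin N → X,
      F x = ρ₂ (∑ c, ρ₁ (∑ i, φ (x c i))) := by
  obtain ⟨φ, hφ⟩ := exists_real_map_sum_eq_imp_perm X
  let s : (Fin N → X) → ℝ := fun u => ∑ i, φ (u i)
  have : Countable (Set.range s) := (Set.countable_range s).to_subtype
  obtain ⟨ψ, hψ⟩ := exists_real_map_sum_eq_imp_perm (Set.range s)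
  let ρ₁ : ℝ → ℝ := Function.extend Subtype.val ψ 0
  have hρ₁ (u : Fin N → X) : ρ₁ (s u) = ψ ⟨s u, u, rfl⟩ :=
    Subtype.val_injective.extend_apply ψ 0 ⟨s u, u, rfl⟩
  let G : (Fin C → Fin N → X) → ℝ := fun x => ∑ c, ρ₁ (s (x c))
  have hFG : F.FactorsThrough G := by
    intro x y hxy
    simp only [G, hρ₁] at hxy
    obtain ⟨σ, hσ⟩ := hψ _ _ hxy
    have hs (c : Fin C) : s (x c) = s (y (σ c)) := congrArg Subtype.val (congrFun hσ c)
    choose τ hτ using fun c => hφ _ _ (hs c)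
    rw [← hF σ τ y]
    exact congrArg F (funext hτ)
  exact ⟨φ, ρ₁, Function.extend G F 0, fun x => (hFG.extend_apply 0 x).symm⟩
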